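/- arXiv:1806.03049 — 4 statements merged into one kernel-verified Lean document; each statement's English description precedes it below -/
import Mathlib

section
/- Lerch's theorem (uniqueness of the Laplace transform): Let f, g : ℝ → ℂ be continuous on [0, ∞) and let r ∈ ℂ with 0 < Re r. Suppose there exist constants M₁ > 0 and a₁ < Re r with ‖f t‖ ≤ M₁ * Real.exp (a₁ * t) for all t ≥ 0, and constants M₂ > 0 and a₂ < Re r with ‖g t‖ ≤ M₂ * Real.exp (a₂ * t) for all t ≥ 0, and suppose that L[f](s) = L[g](s) for every s ∈ ℂ with Re r ≤ Re s. Then f t = g t for all t ≥ 0. -/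
open MeasureTheory

noncomputable def laplaceTransform (f : ℝ → ℂ) (s : ℂ) : ℂ :=
  ∫ t in Set.Ici (0:ℝ), Complex.exp (-(s * t)) * f t

lemma laplace_aux_int (f : ℝ → ℂ) (s : ℂ) (hf : ContinuousOn f (Set.Ici 0))
    (hfb : ∃ M₁ a₁ : ℝ, 0 < M₁ ∧ a₁ < s.re ∧
      ∀ t : ℝ, 0 ≤ t → ‖f t‖ ≤ M₁ * Real.exp (a₁ * t)) :
    IntegrableOn (fun t : ℝ => Complex.exp (-(s * t)) * f t) (Set.Ici 0) := by
  obtain ⟨M, a, hM, ha, hb⟩ := hfb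
  have h1 : IntegrableOn (fun t : ℝ => M * Real.exp ((a - s.re) * t)) (Set.Ici 0) := by
    rw [integrableOn_Ici_iff_integrableOn_Ioi]
    exact (integrableOn_exp_mul_Ioi (by linarith) 0).const_mul M
  refine Integrable.mono' h1 ?_ ?_
  · refine ContinuousOn.aestronglyMeasurable ?_ measurableSet_Ici
    exact ContinuousOn.mul (by fun_prop) hf
  · refine (ae_restrict_iff' measurableSet_Ici).2 (Filter.Eventually.of_forall fun t ht => ?_)
    rw [norm_mul, Complex.norm_exp]
    have h2 : (-(s * (t:ℂ))).re = -s.re * t := by simp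
    rw [h2]
    calc _ ≤ Real.exp (-s.re * t) * (M * Real.exp (a * t)) := by gcongr; exact hb t ht
      _ = M * (Real.exp (-s.re * t) * Real.exp (a * t)) := by ring
      _ = _ := by rw [← Real.exp_add]; ring_nf

open FourierTransform in
theorem lerch_uniqueness (f g : ℝ → ℂ) (r : ℂ)
    (hf : ContinuousOn f (Set.Ici 0)) (hg : ContinuousOn g (Set.Ici 0))
    (hr : 0 < r.re)
    (hfb : ∃ M₁ a₁ : ℝ, 0 < M₁ ∧ a₁ < r.re ∧
      ∀ t : ℝ, 0 ≤ t → ‖f t‖ ≤ M₁ * Real.exp (a₁ * t))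
    (hgb : ∃ M₂ a₂ : ℝ, 0 < M₂ ∧ a₂ < r.re ∧
      ∀ t : ℝ, 0 ≤ t → ‖g t‖ ≤ M₂ * Real.exp (a₂ * t))
    (heq : ∀ s : ℂ, r.re ≤ s.re → laplaceTransform f s = laplaceTransform g s) :
    ∀ t : ℝ, 0 ≤ t → f t = g t := by
  set k : ℝ → ℂ := fun t => Complex.exp (-(r * t)) * f t - Complex.exp (-(r * t)) * g t with hk
  have hkc : ContinuousOn k (Set.Ici 0) :=
    (ContinuousOn.mul (by fun_prop) hf).sub (ContinuousOn.mul (by fun_prop) hg)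
  have hint : Integrable ((Set.Ici (0:ℝ)).indicator k) :=
    (integrable_indicator_iff measurableSet_Ici).2
      ((laplace_aux_int f r hf hfb).sub (laplace_aux_int g r hg hgb))
  have hF : 𝓕 ((Set.Ici (0:ℝ)).indicator k) = 0 := by
    funext w
    have hs : (r + 2 * Real.pi * w * Complex.I).re = r.re := by simp
    have h1 := heq (r + 2 * Real.pi * w * Complex.I) hs.ge
    unfold laplaceTransform at h1
    rw [← sub_eq_zero, ← integral_sub (laplace_aux_int f _ hf (by rwa [hs]))
      (laplace_aux_int g _ hg (by rwa [hs]))] at h1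
    rw [Real.fourier_real_eq_integral_exp_smul, Pi.zero_apply, ← h1,
      ← integral_indicator measurableSet_Ici]
    congr 1
    funext t
    by_cases ht : t ∈ Set.Ici (0:ℝ)
    · rw [Set.indicator_of_mem ht, Set.indicator_of_mem ht, hk]
      simp only [smul_eq_mul]
      rw [mul_sub, ← mul_assoc, ← mul_assoc, ← Complex.exp_add]
      have : ((-2 * Real.pi * t * w : ℝ) : ℂ) * Complex.I + -(r * t)
        = -((r + 2 * Real.pi * w * Complex.I) * t) := by push_cast; ring
      rw [this]
    · rw [Set.indicator_of_notMem ht, Set.indicator_of_notMem ht, smul_zero]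
  have hpos : ∀ t ∈ Set.Ioi (0:ℝ), f t = g t := by
    intro t ht
    have hc : ContinuousAt ((Set.Ici (0:ℝ)).indicator k) t := by
      refine (hkc.continuousAt (Ici_mem_nhds ht)).congr ?_
      filter_upwards [Ici_mem_nhds ht] with x hx
      rw [Set.indicator_of_mem hx]
    have h2 := hint.fourierInv_fourier_eq (by rw [hF]; exact integrable_zero _ _ _) hc
    rw [hF, Set.indicator_of_mem (Set.mem_Ici.2 (le_of_lt ht)), Real.fourierInv_eq] at h2
    simp only [Pi.zero_apply, smul_zero, integral_zero, hk] at h2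
    rw [← mul_sub] at h2
    have := (mul_eq_zero.1 h2.symm).resolve_left (Complex.exp_ne_zero _)
    exact sub_eq_zero.1 this
  have := Set.EqOn.of_subset_closure (s := Set.Ioi (0:ℝ)) (t := Set.Ici 0) hpos hf hg
    Set.Ioi_subset_Ici_self (by rw [closure_Ioi])
  exact fun t ht => this ht
end

section
/- Alternate representation of Lerch's theorem: Let f, g : ℝ → ℂ be continuous on [0, ∞), let a, b, c ∈ ℝ and N ∈ ℕ with a + 1 < N. Suppose ‖f t‖ ≤ b * Real.exp (a * t) and ‖g t‖ ≤ c * Real.exp (a * t) for all t ≥ 0, and that for every natural number n with N ≤ n, L[f]((n : ℂ)) = L[g]((n : ℂ)) (the Laplace transforms agree at the real point s = n). Then f t = g t for all t ≥ 0. -/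
open MeasureTheory

lemma lerch_integrable (f : ℝ → ℂ) (a b : ℝ) (n : ℕ)
    (hf : ContinuousOn f (Set.Ici 0)) (han : a < (n : ℝ))
    (hfb : ∀ t : ℝ, 0 ≤ t → ‖f t‖ ≤ b * Real.exp (a * t)) :
    IntegrableOn (fun t : ℝ => Complex.exp (-((n : ℂ) * t)) * f t) (Set.Ici 0) := by
  have h1 : IntegrableOn (fun t : ℝ => b * Real.exp (-((n : ℝ) - a) * t)) (Set.Ici 0) := by
    rw [integrableOn_Ici_iff_integrableOn_Ioi]
    exact (exp_neg_integrableOn_Ioi 0 (by linarith)).const_mul b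
  refine Integrable.mono' h1 ?_ ?_
  · refine ContinuousOn.aestronglyMeasurable ?_ measurableSet_Ici
    exact ContinuousOn.mul (by fun_prop) hf
  · refine (ae_restrict_iff' measurableSet_Ici).2 (Filter.Eventually.of_forall ?_)
    intro t ht
    have h2 := hfb t ht
    rw [norm_mul, Complex.norm_exp]
    have h3 : (-((n : ℂ) * t)).re = -((n : ℝ) * t) := by simp
    rw [h3]
    calc Real.exp (-((n : ℝ) * t)) * ‖f t‖
        ≤ Real.exp (-((n : ℝ) * t)) * (b * Real.exp (a * t)) := by gcongr
      _ = b * (Real.exp (-((n : ℝ) * t)) * Real.exp (a * t)) := by ring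
      _ = b * Real.exp (-((n : ℝ) - a) * t) := by rw [← Real.exp_add]; ring_nf

lemma lerch_poly (G : ℝ → ℂ)
    (hi : ∀ k : ℕ, IntegrableOn (fun t : ℝ => ((Real.exp (-t) ^ k : ℝ) : ℂ) * G t) (Set.Ici 0))
    (h0 : ∀ k : ℕ, ∫ t in Set.Ici (0:ℝ), ((Real.exp (-t) ^ k : ℝ) : ℂ) * G t = 0)
    (p : Polynomial ℝ) :
    IntegrableOn (fun t : ℝ => ((p.eval (Real.exp (-t)) : ℝ) : ℂ) * G t) (Set.Ici 0) ∧
    ∫ t in Set.Ici (0:ℝ), ((p.eval (Real.exp (-t)) : ℝ) : ℂ) * G t = 0 := by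
  induction p using Polynomial.induction_on' with
  | add p q hp hq =>
    simp only [Polynomial.eval_add, Complex.ofReal_add, add_mul]
    refine ⟨hp.1.add hq.1, ?_⟩
    rw [integral_add hp.1 hq.1, hp.2, hq.2, add_zero]
  | monomial n r =>
    simp only [Polynomial.eval_monomial, Complex.ofReal_mul r, mul_assoc]
    refine ⟨(hi n).const_mul _, ?_⟩
    rw [integral_const_mul, h0 n, mul_zero]

lemma lerch_cont (G : ℝ → ℂ)
    (hi : ∀ k : ℕ, IntegrableOn (fun t : ℝ => ((Real.exp (-t) ^ k : ℝ) : ℂ) * G t) (Set.Ici 0))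
    (h0 : ∀ k : ℕ, ∫ t in Set.Ici (0:ℝ), ((Real.exp (-t) ^ k : ℝ) : ℂ) * G t = 0)
    (φ : ℝ → ℝ) (hφ : Continuous φ) 
    (hφi : IntegrableOn (fun t : ℝ => ((φ (Real.exp (-t)) : ℝ) : ℂ) * G t) (Set.Ici 0)) :
    ∫ t in Set.Ici (0:ℝ), ((φ (Real.exp (-t)) : ℝ) : ℂ) * G t = 0 := by
  have hG : IntegrableOn G (Set.Ici 0) := by simpa using hi 0
  set I := ∫ t in Set.Ici (0:ℝ), ‖G t‖ with hI
  have hI0 : 0 ≤ I := integral_nonneg fun t => norm_nonneg _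
  have key : ∀ ε > 0, ‖∫ t in Set.Ici (0:ℝ), ((φ (Real.exp (-t)) : ℝ) : ℂ) * G t‖ ≤ ε * I := by
    intro ε hε
    obtain ⟨p, hp⟩ := exists_polynomial_near_of_continuousOn 0 1 φ hφ.continuousOn ε hε
    obtain ⟨p1, p2⟩ := lerch_poly G hi h0 p
    rw [← sub_zero (∫ t in Set.Ici (0:ℝ), ((φ (Real.exp (-t)) : ℝ) : ℂ) * G t), ← p2,
      ← integral_sub hφi p1, hI, ← integral_const_mul]
    refine norm_integral_le_of_norm_le (hG.norm.const_mul ε) ?_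
    refine (ae_restrict_iff' measurableSet_Ici).2 (Filter.Eventually.of_forall ?_)
    intro t ht
    rw [← sub_mul, norm_mul, ← Complex.ofReal_sub, Complex.norm_real, Real.norm_eq_abs, abs_sub_comm]
    have := hp (Real.exp (-t)) ⟨(Real.exp_pos _).le, Real.exp_le_one_iff.2 (by simpa using ht)⟩
    gcongr
  rw [← norm_le_zero_iff]
  refine le_of_forall_pos_le_add fun δ hδ => ?_
  refine (key (δ / (I + 1)) (by positivity)).trans ?_
  rw [zero_add, div_mul_eq_mul_div, div_le_iff₀ (by positivity)]
  nlinarith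

theorem lerch_alternate (f g : ℝ → ℂ) (a b c : ℝ) (N : ℕ)
    (hf : ContinuousOn f (Set.Ici 0)) (hg : ContinuousOn g (Set.Ici 0))
    (haN : a + 1 < (N : ℝ))
    (hfb : ∀ t : ℝ, 0 ≤ t → ‖f t‖ ≤ b * Real.exp (a * t))
    (hgb : ∀ t : ℝ, 0 ≤ t → ‖g t‖ ≤ c * Real.exp (a * t))
    (heq : ∀ n : ℕ, N ≤ n → laplaceTransform f (n : ℂ) = laplaceTransform g (n : ℂ)) :
    ∀ t : ℝ, 0 ≤ t → f t = g t := by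
  set G : ℝ → ℂ := fun t => Complex.exp (-((N : ℂ) * t)) * (f t - g t) with hGdef
  have hGc : ContinuousOn G (Set.Ici 0) := ContinuousOn.mul (by fun_prop) (hf.sub hg)
  have hk : ∀ k : ℕ, (fun t : ℝ => ((Real.exp (-t) ^ k : ℝ) : ℂ) * G t) =
      fun t : ℝ => Complex.exp (-(((N + k : ℕ) : ℂ) * t)) * f t
        - Complex.exp (-(((N + k : ℕ) : ℂ) * t)) * g t := by
    intro k
    funext t
    have : Complex.exp (-(((N + k : ℕ) : ℂ) * t)) =
        ((Real.exp (-t) ^ k : ℝ) : ℂ) * Complex.exp (-((N : ℂ) * t)) := by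
      push_cast
      rw [← Complex.exp_nat_mul, ← Complex.exp_add]
      ring_nf
    rw [this, hGdef]
    ring
  have hlt : ∀ k : ℕ, a < ((N + k : ℕ) : ℝ) := by
    intro k
    push_cast
    have : (0:ℝ) ≤ k := Nat.cast_nonneg k
    linarith
  have hi : ∀ k : ℕ,
      IntegrableOn (fun t : ℝ => ((Real.exp (-t) ^ k : ℝ) : ℂ) * G t) (Set.Ici 0) := by
    intro k
    rw [hk]
    exact (lerch_integrable f a b _ hf (hlt k) hfb).sub (lerch_integrable g a c _ hg (hlt k) hgb)
  have h0 : ∀ k : ℕ, ∫ t in Set.Ici (0:ℝ), ((Real.exp (-t) ^ k : ℝ) : ℂ) * G t = 0 := by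
    intro k
    rw [hk, integral_sub (lerch_integrable f a b _ hf (hlt k) hfb)
      (lerch_integrable g a c _ hg (hlt k) hgb)]
    exact sub_eq_zero.2 (heq (N + k) (Nat.le_add_right _ _))
  have hG : IntegrableOn G (Set.Ici 0) := by simpa using hi 0
  have hae : ∀ᵐ t ∂(volume.restrict (Set.Ici (0:ℝ))), G t = 0 := by
    refine ae_eq_zero_of_integral_contDiff_smul_eq_zero (Integrable.locallyIntegrable hG) ?_
    intro ψ hψ hψc
    obtain ⟨R, hR⟩ := hψc.isCompact.isBounded.subset_closedBall 0
    have hz : ∀ t, R < t → ψ t = 0 := by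
      intro t ht
      by_contra h
      have := hR (subset_tsupport ψ h)
      rw [Metric.mem_closedBall, Real.dist_eq, sub_zero] at this
      linarith [le_abs_self t]
    have hcomp : ∀ t, ψ (-Real.log (max (Real.exp (-t)) (Real.exp (-(R + 1))))) = ψ t := by
      intro t
      rcases le_total t (R + 1) with h | h
      · rw [max_eq_left (Real.exp_le_exp.2 (by linarith)), Real.log_exp, neg_neg]
      · rw [max_eq_right (Real.exp_le_exp.2 (by linarith)), Real.log_exp, neg_neg,
          hz _ (by linarith), hz _ (by linarith)]
    have hψi : IntegrableOn (fun t : ℝ => ((ψ t : ℝ) : ℂ) * G t) (Set.Ici 0) := by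
      obtain ⟨C, hC⟩ := hψc.exists_bound_of_continuous hψ.continuous
      refine Integrable.bdd_mul (c := C) hG ?_ ?_
      · exact (Complex.continuous_ofReal.comp hψ.continuous).aestronglyMeasurable
      · exact Filter.Eventually.of_forall fun t => by simpa using hC t
    have := lerch_cont G hi h0 (fun x => ψ (-Real.log (max x (Real.exp (-(R + 1)))))) 
      (hψ.continuous.comp (Continuous.neg (Continuous.log (by fun_prop)
        (fun x => (lt_max_of_lt_right (Real.exp_pos _)).ne')))) (by simpa only [hcomp] using hψi)
    simpa only [hcomp, Complex.real_smul] using this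
  have hE : Set.EqOn G (fun _ => 0) (Set.Ici 0) :=
    Measure.eqOn_of_ae_eq hae hGc continuousOn_const (by simp)
  intro t ht
  have h := hE ht
  exact sub_eq_zero.1 ((mul_eq_zero.1 h).resolve_left (Complex.exp_ne_zero _))
end

section
/- Generalization of Lerch's theorem (vanishing a.e.): Let h : ℝ → ℂ be (a.e.-strongly) measurable on [0, ∞), let a, b ∈ ℝ and N ∈ ℕ with a + 1 < N, and suppose ‖h t‖ ≤ b * Real.exp (a * t) for all t ≥ 0. If L[h]((n : ℂ)) = 0 for every natural number n with N ≤ n, then the set {t | 0 ≤ t ∧ h t ≠ 0} has Lebesgue measure zero, i.e. h = 0 almost everywhere on [0, ∞). -/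
open MeasureTheory

theorem lerch_generalization (h : ℝ → ℂ) (a b : ℝ) (N : ℕ)
    (hm : AEStronglyMeasurable h (volume.restrict (Set.Ici (0:ℝ))))
    (haN : a + 1 < (N : ℝ))
    (hb : ∀ t : ℝ, 0 ≤ t → ‖h t‖ ≤ b * Real.exp (a * t))
    (hL : ∀ n : ℕ, N ≤ n → laplaceTransform h (n : ℂ) = 0) :
    volume {t : ℝ | 0 ≤ t ∧ h t ≠ 0} = 0 := by
  set g : ℝ → ℂ := fun t => Complex.exp (-((N : ℂ) * t)) * h t with hg
  have hgi : IntegrableOn g (Set.Ici 0) := by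
    have h1 : IntegrableOn (fun t : ℝ => b * Real.exp ((a - N) * t)) (Set.Ici 0) := by
      rw [integrableOn_Ici_iff_integrableOn_Ioi]
      exact (integrableOn_exp_mul_Ioi (by linarith) 0).const_mul b
    refine Integrable.mono' h1 ?_ ?_
    · exact AEStronglyMeasurable.mul (Continuous.aestronglyMeasurable (by fun_prop)) hm
    · filter_upwards [ae_restrict_mem measurableSet_Ici] with t ht
      have h2 : ‖Complex.exp (-((N : ℂ) * t))‖ = Real.exp (-(N * t)) := by
        rw [Complex.norm_exp]; simp
      rw [hg, norm_mul, h2]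
      calc _ ≤ Real.exp (-(N * t)) * (b * Real.exp (a * t)) := by
            gcongr; exact hb t ht
        _ = b * (Real.exp (-(N * t)) * Real.exp (a * t)) := by ring
        _ = _ := by rw [← Real.exp_add]; congr 2; ring
  have hle : ∀ t ∈ Set.Ici (0:ℝ), Real.exp (-t) ∈ Set.Icc (0:ℝ) 1 := fun t ht =>
    ⟨(Real.exp_pos _).le, Real.exp_le_one_iff.2 (by simpa using ht)⟩
  -- bounded continuous multiples of `g` are integrable
  have hmul : ∀ (u : ℝ → ℝ), Continuous u → (∃ C, ∀ t ∈ Set.Ici (0:ℝ), ‖u t‖ ≤ C) →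
      IntegrableOn (fun t => (u t : ℂ) * g t) (Set.Ici 0) := by
    rintro u hu ⟨C, hC⟩
    refine Integrable.bdd_mul (c := C) hgi (Continuous.aestronglyMeasurable (by fun_prop)) ?_
    filter_upwards [ae_restrict_mem measurableSet_Ici] with t ht
    simpa using hC t ht
  have hpb : ∀ p : Polynomial ℝ, ∃ C, ∀ t ∈ Set.Ici (0:ℝ), ‖p.eval (Real.exp (-t))‖ ≤ C := by
    intro p
    obtain ⟨C, hC⟩ := (isCompact_Icc (a := (0:ℝ)) (b := 1)).exists_bound_of_continuousOn
      p.continuous.continuousOn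
    exact ⟨C, fun t ht => hC _ (hle t ht)⟩
  have hpi : ∀ p : Polynomial ℝ,
      IntegrableOn (fun t => ((p.eval (Real.exp (-t)) : ℝ) : ℂ) * g t) (Set.Ici 0) := fun p =>
    hmul _ (by fun_prop) (hpb p)
  have hp : ∀ p : Polynomial ℝ,
      ∫ t in Set.Ici (0:ℝ), ((p.eval (Real.exp (-t)) : ℝ) : ℂ) * g t = 0 := by
    intro p
    induction p using Polynomial.induction_on' with
    | add p q hp hq =>
      simp only [Polynomial.eval_add, Complex.ofReal_add, add_mul]
      rw [integral_add (hpi p) (hpi q), hp, hq, add_zero]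
    | monomial n c =>
      have h3 := hL (N + n) (by omega)
      unfold laplaceTransform at h3
      have h4 : ∀ t : ℝ, (((Polynomial.monomial n c).eval (Real.exp (-t)) : ℝ) : ℂ) * g t
          = (c : ℂ) * (Complex.exp (-(((N + n : ℕ) : ℂ) * t)) * h t) := by
        intro t
        have : Complex.exp (-(((N + n : ℕ) : ℂ) * t))
            = Complex.exp (-t) ^ n * Complex.exp (-((N : ℂ) * t)) := by
          rw [← Complex.exp_nat_mul, ← Complex.exp_add]; congr 1; push_cast; ring
        rw [this, hg]
        simp only [Polynomial.eval_monomial]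
        push_cast
        ring
      simp only [h4]
      rw [integral_const_mul, h3, mul_zero]
  have key : ∀ᵐ x ∂(volume : Measure ℝ), x ∈ Set.Ioi (0:ℝ) → g x = 0 := by
    refine isOpen_Ioi.ae_eq_zero_of_integral_contDiff_smul_eq_zero
      (hgi.mono_set Set.Ioi_subset_Ici_self).locallyIntegrableOn ?_
    intro ψ hψ hcs hsupp
    have hz : ∀ t, t ≤ 0 → ψ t = 0 := fun t ht =>
      image_eq_zero_of_notMem_tsupport fun hh => absurd (hsupp hh) (by simpa using ht)
    have hψc := hψ.continuous
    have hφ : Continuous (fun x : ℝ => ψ (-Real.log x)) := by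
      rw [continuous_iff_continuousAt]
      intro x
      by_cases hx : x = 0
      · subst hx
        rw [continuousAt_iff_punctured_nhds]
        have h5 : Filter.Tendsto (fun x : ℝ => -Real.log x) (nhdsWithin 0 {0}ᶜ) Filter.atTop :=
          Filter.tendsto_neg_atBot_atTop.comp Real.tendsto_log_nhdsNE_zero
        have h6 : ∀ᶠ y in Filter.atTop, ψ y = 0 := by
          obtain ⟨R, hR⟩ := hcs.isCompact.bddAbove
          filter_upwards [Filter.eventually_gt_atTop R] with y hy
          exact image_eq_zero_of_notMem_tsupport fun hh => absurd (hR hh) (by simpa using hy)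
        refine tendsto_nhds_of_eventually_eq ?_
        filter_upwards [h5.eventually h6] with y hy
        rw [hy]; simp [hz 0 le_rfl]
      · exact ContinuousAt.comp (f := fun x => -Real.log x) hψc.continuousAt
          (Real.continuousAt_log hx).neg
    have h7 : ∫ x, ψ x • g x = ∫ t in Set.Ici (0:ℝ), (ψ t : ℂ) * g t := by
      rw [← integral_indicator measurableSet_Ici]
      congr 1; ext1 x
      by_cases hx : 0 ≤ x
      · simp [Set.indicator, hx]
      · simp [Set.indicator, hx, hz x (not_le.1 hx).le]
    rw [h7]
    have hψb : ∃ C, ∀ t ∈ Set.Ici (0:ℝ), ‖ψ t‖ ≤ C := by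
      obtain ⟨C, hC⟩ := hcs.exists_bound_of_continuous hψc
      exact ⟨C, fun t _ => hC t⟩
    have hψi := hmul ψ hψc hψb
    set K := ∫ t in Set.Ici (0:ℝ), ‖g t‖ with hK
    have hK0 : 0 ≤ K := integral_nonneg fun _ => norm_nonneg _
    have hbd : ∀ ε > 0, ‖∫ t in Set.Ici (0:ℝ), (ψ t : ℂ) * g t‖ ≤ ε * K := by
      intro ε hε
      obtain ⟨p, hpε⟩ := exists_polynomial_near_of_continuousOn 0 1 _ hφ.continuousOn ε hε
      have h8 : ∫ t in Set.Ici (0:ℝ), (ψ t : ℂ) * g t = ∫ t in Set.Ici (0:ℝ),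
          ((ψ t : ℂ) * g t - ((p.eval (Real.exp (-t)) : ℝ) : ℂ) * g t) := by
        rw [integral_sub hψi (hpi p), hp, sub_zero]
      rw [h8, hK, ← integral_const_mul]
      refine norm_integral_le_of_norm_le (hgi.norm.const_mul ε) ?_
      filter_upwards [ae_restrict_mem measurableSet_Ici] with t ht
      have h9 := hpε _ (hle t ht)
      simp only [Real.log_exp, neg_neg] at h9
      rw [← sub_mul, norm_mul, ← Complex.ofReal_sub, Complex.norm_real, Real.norm_eq_abs,
        abs_sub_comm]
      gcongr
    by_contra hne
    have hpos := norm_pos_iff.2 hne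
    set I := ‖∫ t in Set.Ici (0:ℝ), (ψ t : ℂ) * g t‖
    have h10 := hbd (I / (2 * (K + 1))) (by positivity)
    have h11 : I / (2 * (K + 1)) * K ≤ I / 2 := by
      rw [div_mul_eq_mul_div, div_le_div_iff₀ (by positivity) (by norm_num)]
      nlinarith
    linarith
  have h0 : ∀ᵐ x ∂(volume : Measure ℝ), x ≠ 0 := by
    simp [ae_iff]
  have hfin : ∀ᵐ x ∂(volume : Measure ℝ), ¬ (0 ≤ x ∧ h x ≠ 0) := by
    filter_upwards [key, h0] with x hx hx0
    rintro ⟨h1, h2⟩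
    have := hx (lt_of_le_of_ne h1 (Ne.symm hx0))
    simp [hg, Complex.exp_ne_zero, h2] at this
  simpa [ae_iff] using hfin
end

section
/- Transfer function of a generic n-th order linear system: Let y, x : ℝ → ℂ, let m ≤ n be natural numbers, let α : Fin (n+1) → ℂ and β : Fin (m+1) → ℂ be coefficient families, and let s ∈ ℂ. Suppose: (i) y is n-times differentiable and x is m-times differentiable on [0, ∞), with iterated derivatives y⁽ᵏ⁾ and x⁽ᵏ⁾; (ii) for each k ≤ n the Laplace transform of y⁽ᵏ⁾ exists at s with an exponential-order bound with exponent < Re s, and similarly for each k ≤ m for x⁽ᵏ⁾; (iii) zero initial conditions hold: y⁽ᵏ⁾ 0 = 0 for 0 ≤ k ≤ n - 1 and x⁽ᵏ⁾ 0 = 0 for 0 ≤ k ≤ m - 1; (iv) the differential equation ∑_{k=0}^{n} α k * y⁽ᵏ⁾ t = ∑_{k=0}^{m} β k * x⁽ᵏ⁾ t holds for all t ≥ 0; (v) L[x](s) ≠ 0 and ∑_{k=0}^{n} α k * s^k ≠ 0. Then L[y](s) / L[x](s) = (∑_{k=0}^{m} β k * s^k) / (∑_{k=0}^{n} α k * s^k).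 -/
open MeasureTheory

def laplaceExists (f : ℝ → ℂ) (s : ℂ) : Prop :=
  IntegrableOn (fun t : ℝ => Complex.exp (-(s * t)) * f t) (Set.Ici (0:ℝ))

theorem laplace_deriv_step (f : ℝ → ℂ) (s : ℂ)
    (hf : ∀ t : ℝ, 0 ≤ t → DifferentiableAt ℝ f t)
    (h0 : laplaceExists f s) (h1 : laplaceExists (deriv f) s)
    (hb : ∃ M a : ℝ, 0 < M ∧ a < s.re ∧ ∀ t : ℝ, 0 ≤ t → ‖f t‖ ≤ M * Real.exp (a * t))
    (hz : f 0 = 0) : laplaceTransform (deriv f) s = s * laplaceTransform f s := by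
  obtain ⟨M, a, hM, ha, hb⟩ := hb
  unfold laplaceExists at h0 h1
  unfold laplaceTransform
  have hd : ∀ t ∈ Set.Ici (0:ℝ), HasDerivAt (fun t : ℝ => Complex.exp (-(s * t)) * f t)
      (Complex.exp (-(s * t)) * deriv f t - s * (Complex.exp (-(s * t)) * f t)) t := by
    intro t ht
    have e : HasDerivAt (fun t : ℝ => -(s * (t : ℂ))) (-(s * 1)) t :=
      ((Complex.ofRealCLM.hasDerivAt (x := t)).const_mul s).neg
    have := e.cexp.mul (hf t ht).hasDerivAt
    exact this.congr_deriv (by ring)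
  have hlim : Filter.Tendsto (fun t : ℝ => Complex.exp (-(s * t)) * f t) Filter.atTop
      (nhds 0) := by
    have hg : Filter.Tendsto (fun t : ℝ => M * Real.exp (-((s.re - a) * t))) Filter.atTop
        (nhds 0) := by
      have h := (Real.tendsto_exp_neg_atTop_nhds_zero.comp
        (Filter.tendsto_id.const_mul_atTop (sub_pos.2 ha))).const_mul M
      simpa [Function.comp_def] using h
    refine squeeze_zero_norm' ?_ hg
    filter_upwards [Filter.eventually_ge_atTop 0] with t ht
    rw [norm_mul, Complex.norm_exp]
    have h2 : Real.exp (-((s.re - a) * t)) = Real.exp (-(s.re * t)) * Real.exp (a * t) := by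
      rw [← Real.exp_add]; congr 1; ring
    have h3 : (-(s * (t : ℂ))).re = -(s.re * t) := by simp
    rw [h2, h3]
    calc _ ≤ Real.exp (-(s.re * t)) * (M * Real.exp (a * t)) := by
          gcongr; exact hb t ht
      _ = _ := by ring
  have hi := h1.sub (h0.const_mul s)
  have key := integral_Ioi_of_hasDerivAt_of_tendsto' hd
    (hi.mono_set Set.Ioi_subset_Ici_self) hlim
  rw [← integral_Ici_eq_integral_Ioi, integral_sub h1 (h0.const_mul s),
    integral_const_mul] at key
  simp only [hz, mul_zero, sub_zero] at key
  exact sub_eq_zero.1 key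

theorem laplace_iter (f : ℝ → ℂ) (n : ℕ) (s : ℂ)
    (hf : ∀ k < n, ∀ t : ℝ, 0 ≤ t → DifferentiableAt ℝ (iteratedDeriv k f) t)
    (hL : ∀ k ≤ n, laplaceExists (iteratedDeriv k f) s)
    (hb : ∀ k ≤ n, ∃ M a : ℝ, 0 < M ∧ a < s.re ∧
      ∀ t : ℝ, 0 ≤ t → ‖iteratedDeriv k f t‖ ≤ M * Real.exp (a * t))
    (hz : ∀ k < n, iteratedDeriv k f 0 = 0) (k : ℕ) (hk : k ≤ n) :
    laplaceTransform (iteratedDeriv k f) s = s ^ k * laplaceTransform f s := by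
  induction k with
  | zero => simp
  | succ k ih =>
    have h1 := hL (k + 1) hk
    rw [iteratedDeriv_succ] at h1 ⊢
    rw [laplace_deriv_step _ s (hf k hk) (hL k (by omega)) h1 (hb k (by omega)) (hz k hk),
      ih (by omega)]
    ring

theorem laplace_sum (f : ℝ → ℂ) (n : ℕ) (s : ℂ) (c : Fin (n + 1) → ℂ)
    (hf : ∀ k < n, ∀ t : ℝ, 0 ≤ t → DifferentiableAt ℝ (iteratedDeriv k f) t)
    (hL : ∀ k ≤ n, laplaceExists (iteratedDeriv k f) s)
    (hb : ∀ k ≤ n, ∃ M a : ℝ, 0 < M ∧ a < s.re ∧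
      ∀ t : ℝ, 0 ≤ t → ‖iteratedDeriv k f t‖ ≤ M * Real.exp (a * t))
    (hz : ∀ k < n, iteratedDeriv k f 0 = 0) :
    laplaceTransform (fun t => ∑ k : Fin (n + 1), c k * iteratedDeriv k f t) s =
      (∑ k : Fin (n + 1), c k * s ^ (k : ℕ)) * laplaceTransform f s := by
  have h : ∀ k : Fin (n + 1), c k * laplaceTransform (iteratedDeriv k f) s
      = c k * s ^ (k : ℕ) * laplaceTransform f s := by
    intro k
    rw [laplace_iter f n s hf hL hb hz k (by omega)]; ring
  rw [Finset.sum_mul, ← Finset.sum_congr rfl (fun k _ => h k)]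
  unfold laplaceTransform
  simp_rw [← integral_const_mul]
  rw [← integral_finsetSum]
  · congr 1
    funext t
    rw [Finset.mul_sum]
    exact Finset.sum_congr rfl (fun k _ => by ring)
  · intro k _
    exact (hL k (by omega)).const_mul (c k)

theorem transfer_function_nth_order_system (y x : ℝ → ℂ) (m n : ℕ) (hmn : m ≤ n)
    (α : Fin (n + 1) → ℂ) (β : Fin (m + 1) → ℂ) (s : ℂ)
    (hy : ∀ k < n, ∀ t : ℝ, 0 ≤ t → DifferentiableAt ℝ (iteratedDeriv k y) t)
    (hx : ∀ k < m, ∀ t : ℝ, 0 ≤ t → DifferentiableAt ℝ (iteratedDeriv k x) t)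
    (hLy : ∀ k ≤ n, laplaceExists (iteratedDeriv k y) s)
    (hby : ∀ k ≤ n, ∃ M a : ℝ, 0 < M ∧ a < s.re ∧
      ∀ t : ℝ, 0 ≤ t → ‖iteratedDeriv k y t‖ ≤ M * Real.exp (a * t))
    (hLx : ∀ k ≤ m, laplaceExists (iteratedDeriv k x) s)
    (hbx : ∀ k ≤ m, ∃ M a : ℝ, 0 < M ∧ a < s.re ∧
      ∀ t : ℝ, 0 ≤ t → ‖iteratedDeriv k x t‖ ≤ M * Real.exp (a * t))
    (hzy : ∀ k < n, iteratedDeriv k y 0 = 0)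
    (hzx : ∀ k < m, iteratedDeriv k x 0 = 0)
    (hde : ∀ t : ℝ, 0 ≤ t →
      ∑ k : Fin (n + 1), α k * iteratedDeriv k y t =
        ∑ k : Fin (m + 1), β k * iteratedDeriv k x t)
    (hX : laplaceTransform x s ≠ 0)
    (hα : ∑ k : Fin (n + 1), α k * s ^ (k : ℕ) ≠ 0) :
    laplaceTransform y s / laplaceTransform x s =
      (∑ k : Fin (m + 1), β k * s ^ (k : ℕ)) /
        (∑ k : Fin (n + 1), α k * s ^ (k : ℕ)) := by
  have hy' := laplace_sum y n s α hy hLy hby hzy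
  have hx' := laplace_sum x m s β hx hLx hbx hzx
  have he : laplaceTransform (fun t => ∑ k : Fin (n + 1), α k * iteratedDeriv k y t) s =
      laplaceTransform (fun t => ∑ k : Fin (m + 1), β k * iteratedDeriv k x t) s := by
    unfold laplaceTransform
    refine setIntegral_congr_fun measurableSet_Ici ?_
    intro t ht
    simp only [hde t ht]
  rw [hy', hx'] at he
  rw [div_eq_div_iff hX hα]
  linear_combination he
end
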